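/- Let H be a complex Hilbert space, J and K finite index sets, and let (A_j)_{j∈J}, (Γ_k)_{k∈K}, and (B_{jk})_{j∈J,k∈K} be bounded linear operators on H satisfying: ‖Σ_{j∈J} A_j A_j*‖ ≤ 1, ‖Σ_{k∈K} Γ_k Γ_k*‖ ≤ 1, and the family (B_{jk}) has matrix norm ≤ M. Then for every bounded operator T and every Hilbert–Schmidt operator R on H, the operator W = Σ_{j∈J} Σ_{k∈K} A_j ∘ T ∘ B_{jk} ∘ R ∘ Γ_k is Hilbert–Schmidt with ‖W‖_{S₂} ≤ M · ‖T‖ · ‖R‖_{S₂}. (This is the case p = ∞, q = 2 of the Schatten–von Neumann theorem for triple operator integrals with integrand in the Haagerup tensor product.) -/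

import Mathlib

open scoped InnerProductSpace ContinuousLinearMap

theorem HilbertBasis.hasSum_norm_inner_sq {𝕜 ι H : Type*} [RCLike 𝕜] [NormedAddCommGroup H]
    [InnerProductSpace 𝕜 H] (b : HilbertBasis ι 𝕜 H) (x : H) :
    HasSum (fun i => ‖inner 𝕜 (b i) x‖ ^ 2) (‖x‖ ^ 2) := by
  have h := (b.hasSum_inner_mul_inner x x).mapL (RCLike.reCLM (K := 𝕜))
  have hterm (i : ι) : RCLike.reCLM (inner 𝕜 x (b i) * inner 𝕜 (b i) x) =
      ‖inner 𝕜 (b i) x‖ ^ 2 := by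
    rw [← inner_conj_symm x (b i), RCLike.conj_mul, ← RCLike.ofReal_pow]
    exact RCLike.ofReal_re _
  have hx : RCLike.reCLM (inner 𝕜 x x) = ‖x‖ ^ 2 := inner_self_eq_norm_sq x
  simpa only [hterm, hx] using h

/-- The Hilbert–Schmidt norm of the adjoint equals that of the operator. -/
theorem HilbertBasis.hasSum_norm_adjoint_sq {𝕜 ι H : Type*} [RCLike 𝕜] [NormedAddCommGroup H]
    [InnerProductSpace 𝕜 H] [CompleteSpace H] (b : HilbertBasis ι 𝕜 H) {X : H →L[𝕜] H}
    (hX : Summable fun i => ‖X (b i)‖ ^ 2) :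
    HasSum (fun i => ‖ContinuousLinearMap.adjoint X (b i)‖ ^ 2) (∑' i, ‖X (b i)‖ ^ 2) := by
  have hrow (i : ι) := b.hasSum_norm_inner_sq (X (b i))
  have hcol (j : ι) : HasSum (fun i => ‖inner 𝕜 (b j) (X (b i))‖ ^ 2)
      (‖ContinuousLinearMap.adjoint X (b j)‖ ^ 2) := by
    convert b.hasSum_norm_inner_sq (ContinuousLinearMap.adjoint X (b j)) using 3 with i
    rw [ContinuousLinearMap.adjoint_inner_right, norm_inner_symm]
  have hs : Summable fun p : ι × ι => ‖inner 𝕜 (b p.2) (X (b p.1))‖ ^ 2 :=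
    (summable_prod_of_nonneg fun _ => by positivity).2
      ⟨fun i => (hrow i).summable, by simpa only [(hrow _).tsum_eq] using hX⟩
  have htot := hs.hasSum.prod_fiberwise hrow
  rw [htot.tsum_eq]
  exact ((Equiv.prodComm ι ι).hasSum_iff.2 hs.hasSum).prod_fiberwise hcol

section RowContraction

variable {𝕜 H : Type*} [RCLike 𝕜] [NormedAddCommGroup H] [InnerProductSpace 𝕜 H] [CompleteSpace H]
  {J : Type*} [Fintype J] {A : J → (H →L[𝕜] H)}

theorem sum_norm_adjoint_apply_sq_le
    (hA : ‖∑ j, A j ∘L ContinuousLinearMap.adjoint (A j)‖ ≤ 1) (x : H) :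
    ∑ j, ‖ContinuousLinearMap.adjoint (A j) x‖ ^ 2 ≤ ‖x‖ ^ 2 := by
  set S := ∑ j, A j ∘L ContinuousLinearMap.adjoint (A j) with hS
  have h : ∑ j, ‖ContinuousLinearMap.adjoint (A j) x‖ ^ 2 = RCLike.re (inner 𝕜 (S x) x) := by
    simp only [hS, sum_apply, sum_inner, map_sum,
      ContinuousLinearMap.comp_apply]
    refine Finset.sum_congr rfl fun j _ => ?_
    rw [← ContinuousLinearMap.adjoint_inner_right, inner_self_eq_norm_sq]
  calc _ ≤ ‖S x‖ * ‖x‖ := h.trans_le (re_inner_le_norm _ _)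
    _ ≤ ‖x‖ * ‖x‖ := by
      gcongr
      simpa using S.le_of_opNorm_le hA x
    _ = _ := (sq _).symm

theorem norm_sum_apply_sq_le
    (hA : ‖∑ j, A j ∘L ContinuousLinearMap.adjoint (A j)‖ ≤ 1) (y : J → H) :
    ‖∑ j, A j (y j)‖ ^ 2 ≤ ∑ j, ‖y j‖ ^ 2 := by
  set z := ∑ j, A j (y j) with hz
  have h : ‖z‖ ^ 2 ≤ ∑ j, ‖ContinuousLinearMap.adjoint (A j) z‖ * ‖y j‖ := by
    calc ‖z‖ ^ 2 = RCLike.re (inner 𝕜 z (∑ j, A j (y j))) := by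
          rw [← hz, inner_self_eq_norm_sq]
      _ = ∑ j, RCLike.re (inner 𝕜 (ContinuousLinearMap.adjoint (A j) z) (y j)) := by
          simp only [inner_sum, map_sum, ContinuousLinearMap.adjoint_inner_left]
      _ ≤ _ := Finset.sum_le_sum fun j _ => re_inner_le_norm _ _
  have hcs := Finset.sum_mul_sq_le_sq_mul_sq Finset.univ
    (fun j => ‖ContinuousLinearMap.adjoint (A j) z‖) (fun j => ‖y j‖)
  have hle := mul_le_mul_of_nonneg_right (sum_norm_adjoint_apply_sq_le hA z)
    (Finset.sum_nonneg fun j (_ : j ∈ Finset.univ) => sq_nonneg ‖y j‖)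
  have hsq := pow_le_pow_left₀ (sq_nonneg ‖z‖) h 2
  rcases (sq_nonneg ‖z‖).eq_or_lt with h0 | h0
  · rw [← h0]
    positivity
  · refine le_of_mul_le_mul_left ?_ h0
    linarith [sq (‖z‖ ^ 2)]

/-- Composing a Hilbert–Schmidt operator on the right with a row contraction does not increase
the Hilbert–Schmidt norm. -/
theorem HilbertBasis.summable_and_tsum_norm_comp_sq_le {ι : Type*} (b : HilbertBasis ι 𝕜 H)
    (hA : ‖∑ j, A j ∘L ContinuousLinearMap.adjoint (A j)‖ ≤ 1) {R : H →L[𝕜] H}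
    (hR : Summable fun i => ‖R (b i)‖ ^ 2) :
    (Summable fun i => ∑ j, ‖R (A j (b i))‖ ^ 2) ∧
      ∑' i, ∑ j, ‖R (A j (b i))‖ ^ 2 ≤ ∑' i, ‖R (b i)‖ ^ 2 := by
  have hadj := b.hasSum_norm_adjoint_sq hR
  have hle (i : ι) := sum_norm_adjoint_apply_sq_le hA (ContinuousLinearMap.adjoint R (b i))
  have hsum (j : J) : Summable fun i =>
      ‖ContinuousLinearMap.adjoint (R ∘L A j) (b i)‖ ^ 2 := by
    refine hadj.summable.of_nonneg_of_le (fun _ => by positivity) fun i => ?_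
    rw [ContinuousLinearMap.adjoint_comp]
    exact (Finset.single_le_sum (f := fun j =>
      ‖ContinuousLinearMap.adjoint (A j) (ContinuousLinearMap.adjoint R (b i))‖ ^ 2)
      (fun _ _ => by positivity) (Finset.mem_univ j)).trans (hle i)
  have hcomp (j : J) : HasSum (fun i => ‖R (A j (b i))‖ ^ 2)
      (∑' i, ‖ContinuousLinearMap.adjoint (R ∘L A j) (b i)‖ ^ 2) := by
    simpa using b.hasSum_norm_adjoint_sq (hsum j)
  have htot := hasSum_sum fun j (_ : j ∈ Finset.univ) => hcomp j
  refine ⟨htot.summable, ?_⟩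
  rw [htot.tsum_eq, ← hadj.tsum_eq, ← Summable.tsum_finsetSum fun j _ => hsum j]
  refine (summable_sum fun j _ => hsum j).tsum_le_tsum (fun i => ?_) hadj.summable
  simpa only [ContinuousLinearMap.adjoint_comp, ContinuousLinearMap.comp_apply] using hle i

end RowContraction

/-- Case `p = ∞`, `q = 2` of the Schatten–von Neumann theorem for triple operator
integrals with integrand in the Haagerup tensor product: if `‖∑ j, A j (A j)*‖ ≤ 1`,
`‖∑ k, Γ k (Γ k)*‖ ≤ 1`, the family `(B j k)` has matrix norm at most `M`,
`T` is bounded and `R` is Hilbert–Schmidt, then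
`W = ∑ j, ∑ k, A j ∘ T ∘ B j k ∘ R ∘ Γ k` is Hilbert–Schmidt and
`‖W‖_{S₂} ≤ M * ‖T‖ * ‖R‖_{S₂}`.  Hilbert–Schmidt norms are computed with respect
to a Hilbert basis `b`. -/
theorem triple_operator_integral_Sinfty_S2
    {H : Type*} [NormedAddCommGroup H] [InnerProductSpace ℂ H] [CompleteSpace H]
    {ι : Type*} (b : HilbertBasis ι ℂ H)
    {J K : Type*} [Fintype J] [Fintype K]
    (A : J → (H →L[ℂ] H)) (Γ : K → (H →L[ℂ] H)) (B : J → K → (H →L[ℂ] H))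
    (M : ℝ) (hM : 0 ≤ M)
    (hA : ‖∑ j : J, (A j) ∘L (ContinuousLinearMap.adjoint (A j))‖ ≤ 1)
    (hΓ : ‖∑ k : K, (Γ k) ∘L (ContinuousLinearMap.adjoint (Γ k))‖ ≤ 1)
    (hB : ∀ x : K → H, ∑ j : J, ‖∑ k : K, (B j k) (x k)‖ ^ 2 ≤ M ^ 2 * ∑ k : K, ‖x k‖ ^ 2)
    (T R : H →L[ℂ] H)
    (hR : Summable fun i : ι => ‖R (b i)‖ ^ 2) :
    Summable (fun i : ι =>
        ‖(∑ j : J, ∑ k : K, (A j) ∘L T ∘L (B j k) ∘L R ∘L (Γ k)) (b i)‖ ^ 2) ∧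
      Real.sqrt (∑' i : ι,
          ‖(∑ j : J, ∑ k : K, (A j) ∘L T ∘L (B j k) ∘L R ∘L (Γ k)) (b i)‖ ^ 2)
        ≤ M * ‖T‖ * Real.sqrt (∑' i : ι, ‖R (b i)‖ ^ 2) := by
  obtain ⟨hs, hle⟩ := b.summable_and_tsum_norm_comp_sq_le hΓ hR
  have hpt (i : ι) :
      ‖(∑ j : J, ∑ k : K, (A j) ∘L T ∘L (B j k) ∘L R ∘L (Γ k)) (b i)‖ ^ 2
        ≤ (M * ‖T‖) ^ 2 * ∑ k, ‖R (Γ k (b i))‖ ^ 2 := by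
    calc _ = ‖∑ j, A j (T (∑ k, B j k (R (Γ k (b i)))))‖ ^ 2 := by
          simp [map_sum]
      _ ≤ ∑ j, ‖T (∑ k, B j k (R (Γ k (b i))))‖ ^ 2 := norm_sum_apply_sq_le hA _
      _ ≤ ∑ j, ‖T‖ ^ 2 * ‖∑ k, B j k (R (Γ k (b i)))‖ ^ 2 := by
          gcongr with j
          rw [← mul_pow]
          gcongr
          exact T.le_opNorm _
      _ ≤ ‖T‖ ^ 2 * (M ^ 2 * ∑ k, ‖R (Γ k (b i))‖ ^ 2) := by
          rw [← Finset.mul_sum]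
          gcongr
          exact hB _
      _ = _ := by ring
  have hW := (hs.mul_left ((M * ‖T‖) ^ 2)).of_nonneg_of_le (fun _ => by positivity) hpt
  refine ⟨hW, Real.sqrt_le_iff.2 ⟨by positivity, ?_⟩⟩
  rw [mul_pow, Real.sq_sqrt (tsum_nonneg fun _ => by positivity)]
  refine (hW.tsum_le_tsum hpt (hs.mul_left _)).trans ?_
  rw [tsum_mul_left]
  gcongr
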